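/- Let f, g ∈ I \ {0} be such that s(f) = s(g) = σe_i and LM_h(f) ≠ LM_h(g). Then there exist a, b ∈ K^* such that s(af + bg) <_sign σe_i. -/

import Mathlib

open MvPolynomial

noncomputable section

namespace TropF5

/-- Variable index type: `none` is the homogenizing variable `h`,
`some (.inl i)` is `x i`, `some (.inr i)` is `∂ i` (resp. `ξ i`). -/
abbrev Vars (n : ℕ) := Option (Fin n ⊕ Fin n)

/-- The commutative polynomial ring `K[h, x, ξ]`. -/
abbrev Poly (n : ℕ) (K : Type*) [Field K] := MvPolynomial (Vars n) K

/-- Monomials (exponent vectors) of `K[h,x,ξ]`. -/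
abbrev Mon (n : ℕ) := Vars n →₀ ℕ

/-- Module monomials `h^γ x^α ξ^β e_i` of `K[h,x,ξ]^N`. -/
abbrev MMon (n N : ℕ) := Mon n × Fin N

/-- Total degree of a monomial. -/
def mdeg {n : ℕ} (d : Mon n) : ℕ := d.sum fun _ k => k

/-- The weight `w·(α,β)` of the `(x,ξ)`-part of a monomial. -/
def wdeg {n : ℕ} (w : Fin n ⊕ Fin n → ℝ) (d : Mon n) : ℝ :=
  ∑ j : Fin n ⊕ Fin n, w j * (d (some j) : ℝ)

/-- The `(x,ξ)`-part `x^α ξ^β` of a monomial `h^γ x^α ξ^β`. -/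
def xiPart {n : ℕ} (d : Mon n) : (Fin n ⊕ Fin n) →₀ ℕ :=
  Finsupp.equivFunOnFinite.symm fun j => d (some j)

/-- The data defining a tropical term order on `K[h,x,ξ]`: a valuation on `K`,
weight vectors `w, ω ∈ ℝ^{2n}`, and a monomial order `prec` used as tie-breaker. -/
structure OrdData (n : ℕ) (K : Type*) [Field K] where
  val : K → ℝ
  val_mul : ∀ a b : K, a ≠ 0 → b ≠ 0 → val (a * b) = val a + val b
  val_add : ∀ a b : K, a ≠ 0 → b ≠ 0 → a + b ≠ 0 → min (val a) (val b) ≤ val (a + b)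
  w : Fin n ⊕ Fin n → ℝ
  om : Fin n ⊕ Fin n → ℝ
  w_nonneg : ∀ i : Fin n, 0 ≤ w (Sum.inl i)
  w_big : ∀ i j : Fin n, w (Sum.inl j) < w (Sum.inr i)
  prec : LinearOrder ((Fin n ⊕ Fin n) →₀ ℕ)
  prec_add : ∀ u v t : (Fin n ⊕ Fin n) →₀ ℕ, prec.lt u v → prec.lt (u + t) (v + t)
  prec_zero_le : ∀ u, prec.le 0 u

variable {n N : ℕ} {K : Type*} [Field K]

/-- The strict tropical term order `<_h` on terms `a·d`, `b·e` of `K[h,x,ξ]`: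
first by total degree, then by `w`-weight, then by valuation-adjusted `ω`-weight,
and finally by the tie-breaking monomial order on the `(x,ξ)`-parts. -/
def ltTerm (D : OrdData n K) (a : K) (d : Mon n) (b : K) (e : Mon n) : Prop :=
  mdeg d < mdeg e ∨ (mdeg d = mdeg e ∧
    (wdeg D.w d < wdeg D.w e ∨ (wdeg D.w d = wdeg D.w e ∧
      (-D.val a + wdeg D.om d < -D.val b + wdeg D.om e ∨
        (-D.val a + wdeg D.om d = -D.val b + wdeg D.om e ∧
          D.prec.lt (xiPart d) (xiPart e))))))

/-- `d` is the `≤_h`-leading monomial of the polynomial `p`. -/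
def IsLM (D : OrdData n K) (p : Poly n K) (d : Mon n) : Prop :=
  d ∈ p.support ∧ ∀ e ∈ p.support, e ≠ d → ltTerm D (p.coeff e) e (p.coeff d) d

open Classical in
/-- The `≤_h`-leading monomial of a polynomial (junk value `0` if there is none). -/
def LM (D : OrdData n K) (p : Poly n K) : Mon n :=
  if h : ∃ d, IsLM D p d then h.choose else 0

/-- The module element `σ e_i` of `K[h,x,ξ]^N` corresponding to a module monomial. -/
def msingle {N : ℕ} (m : MMon n N) : Fin N → Poly n K := Pi.single m.2 (monomial m.1 1)

/-- Product of a monomial with a module monomial. -/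
def mulM {N : ℕ} (d : Mon n) (m : MMon n N) : MMon n N := (d + m.1, m.2)

/-- An abstract setting for the homogenized Weyl algebra `R = D_n^{(h)}(K)`:
a `K`-algebra `R` with generators `h, x_i, ∂_i` satisfying the Weyl relations,
the total-symbol `K`-linear isomorphism `Ψ_h : R ≃ K[h,x,ξ]` sending normally
ordered monomials to monomials, a tropical order datum, and a generating family
`F` of homogeneous elements. -/
structure Setting (n N : ℕ) (K : Type*) [Field K] (R : Type*) [Ring R] [Algebra K R] where
  D : OrdData n K
  /-- the generators: `Xg none = h`, `Xg (some (.inl i)) = x i`, `Xg (some (.inr i)) = ∂ i` -/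
  Xg : Vars n → R
  h_comm : ∀ v, Xg none * Xg v = Xg v * Xg none
  x_comm : ∀ i j : Fin n,
    Xg (some (Sum.inl i)) * Xg (some (Sum.inl j)) = Xg (some (Sum.inl j)) * Xg (some (Sum.inl i))
  d_comm : ∀ i j : Fin n,
    Xg (some (Sum.inr i)) * Xg (some (Sum.inr j)) = Xg (some (Sum.inr j)) * Xg (some (Sum.inr i))
  dx_comm : ∀ i j : Fin n, i ≠ j →
    Xg (some (Sum.inr i)) * Xg (some (Sum.inl j)) = Xg (some (Sum.inl j)) * Xg (some (Sum.inr i))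
  dx_h : ∀ i : Fin n,
    Xg (some (Sum.inr i)) * Xg (some (Sum.inl i))
      = Xg (some (Sum.inl i)) * Xg (some (Sum.inr i)) + Xg none ^ 2
  /-- the total symbol map `Ψ_h` -/
  Psi : R ≃ₗ[K] Poly n K
  Psi_monomial : ∀ d : Mon n,
    Psi (Xg none ^ d none *
      ((List.ofFn fun i : Fin n => Xg (some (Sum.inl i)) ^ d (some (Sum.inl i))).prod *
       (List.ofFn fun i : Fin n => Xg (some (Sum.inr i)) ^ d (some (Sum.inr i))).prod)) =
    monomial d 1
  /-- the generating set `F = {f_1, …, f_N}` -/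
  F : Fin N → R
  F_hom : ∀ i, ∃ dF : ℕ, (Psi (F i)).IsHomogeneous dF

namespace Setting

variable {R : Type*} [Ring R] [Algebra K R] [NeZero N] (S : Setting n N K R)

/-- `ν : R^N → I`, `ν(a) = Σ a_i f_i`. -/
def nu (g : Fin N → R) : R := ∑ i, g i * S.F i

/-- The left ideal `I` generated by `F`. -/
def idl : Submodule R R := Submodule.span R (Set.range S.F)

/-- The componentwise total symbol map `Φ : R^N → K[h,x,ξ]^N`. -/
def Phi (g : Fin N → R) : Fin N → Poly n K := fun i => S.Psi (g i)

/-- The inverse total symbol of a monomial: the monomial `h^γ x^α ∂^β` of `R`. -/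
def monR (d : Mon n) : R := S.Psi.symm (monomial d 1)

/-- `t` is a term (nonzero coefficient times a monomial) of `R`. -/
def IsTermR (t : R) : Prop := ∃ (d : Mon n) (c : K), c ≠ 0 ∧ S.Psi t = monomial d c

/-- `≤_h`-leading monomial of an element of `R` (via its total symbol). -/
def LMr (f : R) : Mon n := LM S.D (S.Psi f)

/-- `≤_h`-leading coefficient of an element of `R`. -/
def LCr (f : R) : K := (S.Psi f).coeff (S.LMr f)

/-- `LT_h f ≤_h LT_h g` (strictly smaller, or equal monomials and equal valuations). -/
def leLT (f g : R) : Prop :=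
  ltTerm S.D (S.LCr f) (S.LMr f) (S.LCr g) (S.LMr g) ∨
    (S.D.val (S.LCr f) = S.D.val (S.LCr g) ∧ S.LMr f = S.LMr g)


/-- `m` is the leading monomial of the syzygy `a`: writing `m = (d, i)`,
`i` is the largest index with `a i ≠ 0` and `d = LM_h (a i)`. -/
def IsSyzLM (m : MMon n N) : Prop :=
  ∃ a : Fin N → R, S.nu a = 0 ∧ a m.2 ≠ 0 ∧ (∀ j, m.2 < j → a j = 0) ∧
    IsLM S.D (S.Psi (a m.2)) m.1

/-- `LSyz(F)`: the `K[h,x,ξ]`-submodule generated by leading monomials of syzygies. -/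
def LSyz : Submodule (Poly n K) (Fin N → Poly n K) :=
  Submodule.span _ { v | ∃ m : MMon n N, S.IsSyzLM m ∧ v = msingle m }

/-- Membership of a module monomial in `LSyz(F)`. -/
def inLSyz (m : MMon n N) : Prop := msingle m ∈ S.LSyz

/-- The strict total order `<_sign` on module monomials. -/
def ltSign (m m' : MMon n N) : Prop :=
  m.2 < m'.2 ∨ (m.2 = m'.2 ∧ (mdeg m.1 < mdeg m'.1 ∨ (mdeg m.1 = mdeg m'.1 ∧
    (wdeg S.D.w m.1 < wdeg S.D.w m'.1 ∨ (wdeg S.D.w m.1 = wdeg S.D.w m'.1 ∧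
      ((¬ S.inLSyz m ∧ S.inLSyz m') ∨
        ((S.inLSyz m ↔ S.inLSyz m') ∧ S.D.prec.lt (xiPart m.1) (xiPart m'.1))))))))

/-- `m` is the `≤_sign`-largest module monomial of `Φ(g)`. -/
def IsLMsign (g : Fin N → R) (m : MMon n N) : Prop :=
  m.1 ∈ (S.Psi (g m.2)).support ∧
    ∀ m' : MMon n N, m'.1 ∈ (S.Psi (g m'.2)).support → m' ≠ m → S.ltSign m' m

open Classical in
/-- `LM_sign(g)` (junk value if there is none). -/
def LMsign (g : Fin N → R) : MMon n N :=
  if h : ∃ m, S.IsLMsign g m then h.choose else ((0 : Mon n), (0 : Fin N))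

/-- `m` is the signature of `f`: the `≤_sign`-minimum of
`{LM_sign(g) : ν(g) = f}`. -/
def IsSig (f : R) (m : MMon n N) : Prop :=
  (∃ g : Fin N → R, S.nu g = f ∧ S.IsLMsign g m) ∧
    ∀ (g : Fin N → R) (m' : MMon n N), S.nu g = f → S.IsLMsign g m' → ¬ S.ltSign m' m

open Classical in
/-- The signature `s(f)` of `f ∈ I \ {0}` (junk value if there is none). -/
def sig (f : R) : MMon n N :=
  if h : ∃ m, S.IsSig f m then h.choose else ((0 : Mon n), (0 : Fin N))


/-- A module element is clean if `ν(g) ≠ 0` and no module monomial of `Φ(g)`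
belongs to `LSyz(F)`. -/
def Clean (g : Fin N → R) : Prop :=
  S.nu g ≠ 0 ∧ ∀ m : MMon n N, m.1 ∈ (S.Psi (g m.2)).support → ¬ S.inLSyz m

/-- `f` is `s`-top-reducible with respect to the module monomial `m`:
some `g ∈ I \ {0}` and term `t` satisfy `LM_h(t g) = LM_h(f)` and `s(t g) <_sign m`. -/
def sTopRed (f : R) (m : MMon n N) : Prop :=
  ∃ g ∈ S.idl, g ≠ 0 ∧ ∃ t : R, S.IsTermR t ∧
    S.LMr (t * g) = S.LMr f ∧ S.ltSign (S.sig (t * g)) m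

/-- `f` is `s`-top-irreducible with respect to `m`. -/
def sTopIrr (f : R) (m : MMon n N) : Prop := f = 0 ∨ ¬ S.sTopRed f m

/-- `σ` is the value `Ω(m)`: the `≤_sign`-minimum of
`{s(f) : f ∈ I \ {0}, LM_h(f) = m}`. -/
def IsOmega (m : Mon n) (σ : MMon n N) : Prop :=
  (∃ f, f ∈ S.idl ∧ f ≠ 0 ∧ S.LMr f = m ∧ S.sig f = σ) ∧
    ∀ f, f ∈ S.idl → f ≠ 0 → S.LMr f = m → ¬ S.ltSign (S.sig f) σ

open Classical in
/-- The map `Ω` (junk value if the minimum does not exist). -/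
def Omega (m : Mon n) : MMon n N :=
  if h : ∃ σ, S.IsOmega m σ then h.choose else ((0 : Mon n), (0 : Fin N))

/-- `G` is an `s`-Gröbner basis of `I`. -/
def IsSGB (G : Set R) : Prop :=
  G.Nonempty ∧ Submodule.span R G = S.idl ∧
    ∀ f ∈ S.idl, f ≠ 0 → S.sTopIrr f (S.sig f) →
      ∃ g ∈ G, ∃ d : Mon n,
        S.LMr (S.monR d * g) = S.LMr f ∧ mulM d (S.sig g) = S.sig f

/-- `G` is a (tropical) Gröbner basis of `I`:
`RG = I` and `⟨LM_h(G)⟩ = ⟨LM_h(I)⟩`. -/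
def IsGB (G : Set R) : Prop :=
  G.Nonempty ∧ Submodule.span R G = S.idl ∧
    Ideal.span ((fun g => (monomial (S.LMr g) 1 : Poly n K)) '' {g | g ∈ G ∧ g ≠ 0}) =
      Ideal.span ((fun g => (monomial (S.LMr g) 1 : Poly n K)) '' {f | f ∈ S.idl ∧ f ≠ 0})

/-- `g` is primitive `s`-top-irreducible. -/
def Primitive (g : R) : Prop :=
  g ∈ S.idl ∧ g ≠ 0 ∧ S.sTopIrr g (S.sig g) ∧
    ¬ ∃ g', g' ∈ S.idl ∧ g' ≠ 0 ∧ S.sTopIrr g' (S.sig g') ∧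
      ∃ d : Mon n, d ≠ 0 ∧ S.LMr (S.monR d * g') = S.LMr g ∧
        S.sig (S.monR d * g') = S.sig g

/-- `f` is redundant to `G`. -/
def Redundant (f : R) (G : Set R) : Prop :=
  f ≠ 0 ∧ ∃ g ∈ G, ∃ (d : Mon n) (c : K), c ≠ 0 ∧
    f = S.Psi.symm (monomial d c) * g ∧ S.ltSign (S.sig f) (mulM d (S.sig g))

/-- The cofactor `u_1` of the S-pair of `(g_1, g_2)`. -/
def u1 (g1 g2 : R) : R :=
  S.Psi.symm (monomial ((S.LMr g1 ⊔ S.LMr g2) - S.LMr g1) (S.LCr g2))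

/-- The cofactor `u_2` of the S-pair of `(g_1, g_2)`. -/
def u2 (g1 g2 : R) : R :=
  S.Psi.symm (monomial ((S.LMr g1 ⊔ S.LMr g2) - S.LMr g2) (S.LCr g1))

/-- The S-pair `spair(g_1, g_2) = u_1 g_1 - u_2 g_2`. -/
def spair (g1 g2 : R) : R := S.u1 g1 g2 * g1 - S.u2 g1 g2 * g2

/-- `(g_1, g_2)` is a normal pair relative to `G`. -/
def NormalPair (G : Set R) (g1 g2 : R) : Prop :=
  S.Primitive g1 ∧ S.Primitive g2 ∧
    S.sig (S.u1 g1 g2 * g1) = mulM ((S.LMr g1 ⊔ S.LMr g2) - S.LMr g1) (S.sig g1) ∧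
    S.sig (S.u2 g1 g2 * g2) = mulM ((S.LMr g1 ⊔ S.LMr g2) - S.LMr g2) (S.sig g2) ∧
    S.sig (S.u1 g1 g2 * g1) ≠ S.sig (S.u2 g1 g2 * g2) ∧
    ¬ S.Redundant (S.spair g1 g2) G

end Setting

end TropF5

namespace TropF5

variable {n N : ℕ} {K R : Type*} [Field K] [Ring R] [Algebra K R]

lemma finite_setOf_mdeg_eq (k : ℕ) : {d : Mon n | mdeg d = k}.Finite :=
  (Finsupp.finite_of_degree_le k).subset fun _ hd => le_of_eq hd

/-- A monomial is determined by its `(x,ξ)`-part and its total degree. -/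
lemma eq_of_xiPart_eq_of_mdeg_eq {d e : Mon n} (hx : xiPart d = xiPart e)
    (hd : mdeg d = mdeg e) : d = e := by
  have hs : ∀ j, d (some j) = e (some j) := fun j => DFunLike.congr_fun hx j
  have key : ∀ c : Mon n, mdeg c = c none + ∑ j, c (some j) := fun c => by
    rw [mdeg, Finsupp.sum_fintype _ _ (fun _ => rfl), Fintype.sum_option]
  have hn : d none = e none := by
    rw [key, key] at hd
    simpa [hs] using hd
  ext (_ | j)
  · exact hn
  · exact hs j

lemma ltTerm_mul_left_iff (D : OrdData n K) {c a b : K} (hc : c ≠ 0) (ha : a ≠ 0) (hb : b ≠ 0)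
    (d e : Mon n) : ltTerm D (c * a) d (c * b) e ↔ ltTerm D a d b e := by
  simp only [ltTerm, D.val_mul c a hc ha, D.val_mul c b hc hb, neg_add, add_assoc,
    add_lt_add_iff_left, add_right_inj]

lemma isLM_smul_iff (D : OrdData n K) {c : K} (hc : c ≠ 0) (p : Poly n K) (d : Mon n) :
    IsLM D (c • p) d ↔ IsLM D p d := by
  have hs : (c • p).support = p.support := by
    ext e
    simp [hc]
  rw [IsLM, IsLM, hs]
  refine and_congr_right fun hd => forall₂_congr fun e he => imp_congr_right fun _ => ?_
  rw [coeff_smul, coeff_smul]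
  exact ltTerm_mul_left_iff D hc (mem_support_iff.1 he) (mem_support_iff.1 hd) e d

lemma LM_smul (D : OrdData n K) {c : K} (hc : c ≠ 0) (p : Poly n K) :
    LM D (c • p) = LM D p := by
  have h : IsLM D (c • p) = IsLM D p := funext fun d => propext (isLM_smul_iff D hc p d)
  unfold LM
  rw [h]

namespace Setting

variable (S : Setting n N K R)

lemma LMr_smul {c : K} (hc : c ≠ 0) (f : R) : S.LMr (c • f) = S.LMr f := by
  rw [LMr, LMr, map_smul, LM_smul S.D hc]

lemma nu_add (u v : Fin N → R) : S.nu (u + v) = S.nu u + S.nu v := by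
  simp [nu, add_mul, Finset.sum_add_distrib]

lemma nu_smul (c : K) (u : Fin N → R) : S.nu (c • u) = c • S.nu u := by
  simp [nu, Finset.smul_sum]

lemma exists_nu_eq {f : R} (hf : f ∈ S.idl) : ∃ u, S.nu u = f := by
  obtain ⟨u, hu⟩ := (Submodule.mem_span_range_iff_exists_fun R).1 hf
  exact ⟨u, hu⟩

lemma ltSign_irrefl (m : MMon n N) : ¬ S.ltSign m m := by
  have h : ¬ S.D.prec.lt (xiPart m.1) (xiPart m.1) := @lt_irrefl _ S.D.prec.toPreorder _
  simp [ltSign, h]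

lemma ltSign_trans {a b c : MMon n N} (hab : S.ltSign a b) (hbc : S.ltSign b c) :
    S.ltSign a c := by
  have h : S.D.prec.lt (xiPart a.1) (xiPart b.1) → S.D.prec.lt (xiPart b.1) (xiPart c.1) →
      S.D.prec.lt (xiPart a.1) (xiPart c.1) := @lt_trans _ S.D.prec.toPreorder _ _ _
  unfold ltSign at *
  generalize S.D.prec.lt (xiPart a.1) (xiPart b.1) = p at *
  generalize S.D.prec.lt (xiPart b.1) (xiPart c.1) = q at *
  generalize S.D.prec.lt (xiPart a.1) (xiPart c.1) = r at *
  grind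

lemma ltSign_trichotomy (a b : MMon n N) : S.ltSign a b ∨ a = b ∨ S.ltSign b a := by
  have h : S.D.prec.lt (xiPart a.1) (xiPart b.1) ∨ xiPart a.1 = xiPart b.1 ∨
      S.D.prec.lt (xiPart b.1) (xiPart a.1) := @lt_trichotomy _ S.D.prec _ _
  have heq : xiPart a.1 = xiPart b.1 → mdeg a.1 = mdeg b.1 → a.2 = b.2 → a = b :=
    fun hx hd hi => Prod.ext (eq_of_xiPart_eq_of_mdeg_eq hx hd) hi
  unfold ltSign
  generalize S.D.prec.lt (xiPart a.1) (xiPart b.1) = p at *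
  generalize S.D.prec.lt (xiPart b.1) (xiPart a.1) = q at *
  grind

instance : IsStrictOrder (MMon n N) S.ltSign where
  irrefl := S.ltSign_irrefl
  trans _ _ _ := S.ltSign_trans

lemma wellFounded_ltSign : WellFounded S.ltSign := by
  let key : MMon n N → Fin N ×ₗ ℕ := fun m => toLex (m.2, mdeg m.1)
  have hfiber : ∀ k, (key ⁻¹' {k}).Finite := fun k => by
    refine ((finite_setOf_mdeg_eq (ofLex k).2).prod (Set.finite_singleton (ofLex k).1)).subset ?_
    rintro m rfl
    exact ⟨rfl, rfl⟩
  refine (WellFounded.prod_lex_of_wellFoundedOn_fiber (f := key) (g := id)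
    (wellFounded_lt.onFun (f := key)) fun k =>
      (hfiber k).wellFoundedOn (r := S.ltSign)).mono fun a b h => ?_
  rw [Function.onFun, Prod.lex_iff]
  rcases h with h1 | ⟨h1, h2 | h2⟩
  · exact Or.inl (Prod.Lex.left _ _ h1)
  · exact Or.inl (Prod.Lex.lt_iff.2 (Or.inr ⟨h1, h2⟩))
  · exact Or.inr ⟨congrArg toLex (Prod.ext h1 h2.1), Or.inr ⟨h1, Or.inr h2⟩⟩

/-- The module monomials occurring in `Φ(u)`. -/
def monomials (u : Fin N → R) : Set (MMon n N) := {m | m.1 ∈ (S.Psi (u m.2)).support}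

lemma finite_monomials (u : Fin N → R) : (S.monomials u).Finite := by
  refine ((Set.finite_iUnion fun i => (S.Psi (u i)).support.finite_toSet).prod
    Set.finite_univ).subset fun m hm => ⟨Set.mem_iUnion.2 ⟨m.2, hm⟩, trivial⟩

lemma monomials_nonempty {u : Fin N → R} (hu : u ≠ 0) : (S.monomials u).Nonempty := by
  obtain ⟨i, hi⟩ := Function.ne_iff.1 hu
  have h : S.Psi (u i) ≠ 0 := fun h => hi (S.Psi.map_eq_zero_iff.1 h)
  obtain ⟨d, hd⟩ := support_nonempty.2 h
  exact ⟨(d, i), hd⟩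

lemma exists_isLMsign {u : Fin N → R} (hu : u ≠ 0) : ∃ m, S.IsLMsign u m := by
  have hwf : (S.monomials u).WellFoundedOn (Function.swap S.ltSign) :=
    (S.finite_monomials u).wellFoundedOn
  obtain ⟨⟨m, hm⟩, -, hmax⟩ := WellFounded.has_min hwf Set.univ
    ⟨⟨_, (S.monomials_nonempty hu).some_mem⟩, trivial⟩
  refine ⟨m, hm, fun m' hm' hne => ?_⟩
  have hnot : ¬ S.ltSign m m' := hmax ⟨m', hm'⟩ trivial
  exact (S.ltSign_trichotomy m' m).resolve_right fun h => h.elim hne hnot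

lemma ne_zero_of_nu_ne_zero {u : Fin N → R} (h : S.nu u ≠ 0) : u ≠ 0 := by
  rintro rfl
  simp [nu] at h

lemma exists_isSig {f : R} (hf : f ∈ S.idl) (hf0 : f ≠ 0) : ∃ m, S.IsSig f m := by
  obtain ⟨u, rfl⟩ := S.exists_nu_eq hf
  obtain ⟨m, hm⟩ := S.exists_isLMsign (S.ne_zero_of_nu_ne_zero hf0)
  obtain ⟨m₀, h₀, hmin⟩ := S.wellFounded_ltSign.has_min
    {m | ∃ v, S.nu v = S.nu u ∧ S.IsLMsign v m} ⟨m, u, rfl, hm⟩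
  exact ⟨m₀, h₀, fun v m' hv hm' => hmin m' ⟨v, hv, hm'⟩⟩

variable [NeZero N]

lemma isSig_sig {f : R} (hf : f ∈ S.idl) (hf0 : f ≠ 0) : S.IsSig f (S.sig f) := by
  rw [sig, dif_pos (S.exists_isSig hf hf0)]
  exact (S.exists_isSig hf hf0).choose_spec

end Setting

end TropF5

open TropF5 MvPolynomial

variable {n N : ℕ} [NeZero N] {K R : Type*} [Field K] [Ring R] [Algebra K R]

/-- Lemma `sig_af_bg`. If `f, g ∈ I \ {0}` have the same signature
`σe_i` and different leading monomials, then some `K^*`-combination has strictly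
smaller signature. -/
theorem stmt7 (S : Setting n N K R) (f g : R)
    (hf : f ∈ S.idl) (hf0 : f ≠ 0) (hg : g ∈ S.idl) (hg0 : g ≠ 0)
    (σd : Mon n) (i : Fin N)
    (hsf : S.sig f = (σd, i)) (hsg : S.sig g = (σd, i))
    (hlm : S.LMr f ≠ S.LMr g) :
    ∃ a b : K, a ≠ 0 ∧ b ≠ 0 ∧ S.ltSign (S.sig (a • f + b • g)) (σd, i) := by
  obtain ⟨⟨u, rfl, hu⟩, -⟩ := hsf ▸ S.isSig_sig hf hf0
  obtain ⟨⟨v, rfl, hv⟩, -⟩ := hsg ▸ S.isSig_sig hg hg0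
  set a : K := (S.Psi (v i)).coeff σd with ha
  set c : K := (S.Psi (u i)).coeff σd with hc
  have ha0 : a ≠ 0 := mem_support_iff.1 hv.1
  have hc0 : c ≠ 0 := mem_support_iff.1 hu.1
  refine ⟨a, -c, ha0, neg_ne_zero.2 hc0, ?_⟩
  have hnu : S.nu (a • u + (-c) • v) = a • S.nu u + (-c) • S.nu v := by
    rw [S.nu_add, S.nu_smul, S.nu_smul]
  have hne : a • S.nu u + (-c) • S.nu v ≠ 0 := fun h => hlm <| by
    rw [neg_smul, add_neg_eq_zero] at h
    rw [← S.LMr_smul ha0, h, S.LMr_smul hc0]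
  have hmem : a • S.nu u + (-c) • S.nu v ∈ S.idl := by
    rw [← smul_one_mul a (S.nu u), ← smul_one_mul (-c) (S.nu v)]
    exact S.idl.add_mem (S.idl.smul_mem _ hf) (S.idl.smul_mem _ hg)
  obtain ⟨m, hm⟩ := S.exists_isLMsign (S.ne_zero_of_nu_ne_zero (hnu ▸ hne))
  have hcoeff : ∀ m' : MMon n N, (S.Psi ((a • u + (-c) • v) m'.2)).coeff m'.1 =
      a * (S.Psi (u m'.2)).coeff m'.1 - c * (S.Psi (v m'.2)).coeff m'.1 := fun m' => by
    simp [sub_eq_add_neg]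
  have hlt : S.ltSign m (σd, i) := by
    have hm0 := mem_support_iff.1 hm.1
    rw [hcoeff] at hm0
    have hmσ : m ≠ (σd, i) := by
      rintro rfl
      exact hm0 (by rw [← ha, ← hc, mul_comm, sub_self])
    by_cases hmu : m.1 ∈ (S.Psi (u m.2)).support
    · exact hu.2 m hmu hmσ
    · refine hv.2 m (mem_support_iff.2 fun h => hm0 ?_) hmσ
      rw [notMem_support_iff.1 hmu, h, mul_zero, mul_zero, sub_zero]
  rcases S.ltSign_trichotomy (S.sig (a • S.nu u + (-c) • S.nu v)) m with h | h | h
  · exact S.ltSign_trans h hlt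
  · exact h ▸ hlt
  · exact absurd h ((S.isSig_sig hmem hne).2 _ m hnu hm)

end
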